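/- arXiv:1410.5604 — 9 statements merged into one kernel-verified Lean document; each statement's English description precedes it below -/
import Mathlib

section
/- Every Z₂[x]-submodule C of R_{r,s} = Z₂[x]/(x^r−1) × Z₂[x]/(x^s−1) is finitely generated; more precisely, there exist polynomials b(x), ℓ(x) ∈ Z₂[x] with b(x) dividing x^r−1, and a(x) ∈ Z₂[x] with a(x) dividing x^s−1, such that C is the Z₂[x]-submodule generated by the two elements (b(x) | 0) and (ℓ(x) | a(x)). -/
open Polynomial

noncomputable section

/-- The polynomial ring `Z₂[x]`. -/
abbrev Z2P : Type := Polynomial (ZMod 2)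

/-- The quotient ring `Z₂[x]/(x^n - 1)`. -/
abbrev Rq (n : ℕ) : Type := Z2P ⧸ Ideal.span {(X : Z2P) ^ n - 1}

/-- The canonical projection `Z₂[x] → Z₂[x]/(x^n - 1)`. -/
def mkQ (n : ℕ) : Z2P →+* Rq n := Ideal.Quotient.mk _

/-- A submodule of a product of two cyclic quotients of a principal ideal ring is generated by two
elements in triangular form. -/
theorem Submodule.exists_eq_span_pair_of_quotient_prod {R : Type*} [CommRing R]
    [IsPrincipalIdealRing R] (f g : R)
    (C : Submodule R ((R ⧸ Ideal.span {f}) × (R ⧸ Ideal.span {g}))) :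
    ∃ b l a : R, b ∣ f ∧ a ∣ g ∧
      C = Submodule.span R {(Ideal.Quotient.mk (Ideal.span {f}) b, 0),
        (Ideal.Quotient.mk (Ideal.span {f}) l, Ideal.Quotient.mk (Ideal.span {g}) a)} := by
  let I : Ideal R :=
    C.comap (LinearMap.inl R _ _ ∘ₗ (Ideal.span {f}).mkQ)
  let J : Ideal R := (C.map (LinearMap.snd R _ _)).comap (Ideal.span {g}).mkQ
  have mem_I (p : R) : p ∈ I ↔ (Ideal.Quotient.mk (Ideal.span {f}) p, 0) ∈ C := Iff.rfl
  have mem_J (p : R) : p ∈ J ↔ ∃ u ∈ C, u.2 = Ideal.Quotient.mk (Ideal.span {g}) p := Iff.rfl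
  obtain ⟨b, hb⟩ := IsPrincipalIdealRing.principal I
  obtain ⟨a, ha⟩ := IsPrincipalIdealRing.principal J
  have mem_I_iff (p : R) : p ∈ I ↔ b ∣ p := by rw [hb]; exact Ideal.mem_span_singleton
  have mem_J_iff (p : R) : p ∈ J ↔ a ∣ p := by rw [ha]; exact Ideal.mem_span_singleton
  obtain ⟨⟨u, v⟩, huC, hv⟩ := (mem_J a).1 ((mem_J_iff a).2 dvd_rfl)
  obtain ⟨l, rfl⟩ := Ideal.Quotient.mk_surjective u
  obtain rfl : v = Ideal.Quotient.mk (Ideal.span {g}) a := hv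
  have hbC := (mem_I b).1 ((mem_I_iff b).2 dvd_rfl)
  refine ⟨b, l, a, (mem_I_iff f).1 ((mem_I f).2 ?_), (mem_J_iff g).1 ((mem_J g).2 ?_),
    le_antisymm ?_ ?_⟩
  · rw [Ideal.Quotient.mk_singleton_self]
    exact C.zero_mem
  · exact ⟨0, C.zero_mem, (Ideal.Quotient.mk_singleton_self g).symm⟩
  · rintro ⟨y, z⟩ hyz
    obtain ⟨y, rfl⟩ := Ideal.Quotient.mk_surjective y
    obtain ⟨z, rfl⟩ := Ideal.Quotient.mk_surjective z
    obtain ⟨k, rfl⟩ := (mem_J_iff z).1 ((mem_J z).2 ⟨_, hyz, rfl⟩)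
    have hsub : y - k * l ∈ I := by
      rw [mem_I]
      convert C.sub_mem hyz (C.smul_mem k huC) using 1
      ext
      · simp [Algebra.smul_def]
      · simp [Algebra.smul_def, mul_comm]
    obtain ⟨m, hm⟩ := (mem_I_iff _).1 hsub
    refine Submodule.mem_span_pair.2 ⟨m, k, ?_⟩
    obtain rfl : y = b * m + k * l := by rw [← hm]; ring
    ext
    · simp [Algebra.smul_def, mul_comm]
    · simp [Algebra.smul_def, mul_comm]
  · rw [Submodule.span_le, Set.insert_subset_iff, Set.singleton_subset_iff]
    exact ⟨hbC, huC⟩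

/-- Every `Z₂[x]`-submodule `C` of `R_{r,s} = Z₂[x]/(x^r−1) × Z₂[x]/(x^s−1)` is finitely
generated; more precisely, there are `b ∣ x^r−1`, `ℓ`, and `a ∣ x^s−1` such that
`C = ⟨(b | 0), (ℓ | a)⟩`. -/
theorem stmt0 (r s : ℕ) (hr : 0 < r) (hs : 0 < s)
    (C : Submodule Z2P (Rq r × Rq s)) :
    C.FG ∧
    ∃ b l a : Z2P, b ∣ (X : Z2P) ^ r - 1 ∧ a ∣ (X : Z2P) ^ s - 1 ∧
      C = Submodule.span Z2P {((mkQ r b, 0) : Rq r × Rq s), (mkQ r l, mkQ s a)} := by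
  obtain ⟨b, l, a, hb, ha, hC⟩ :=
    Submodule.exists_eq_span_pair_of_quotient_prod ((X : Z2P) ^ r - 1) ((X : Z2P) ^ s - 1) C
  refine ⟨?_, b, l, a, hb, ha, hC⟩
  rw [hC]
  exact Submodule.fg_span (Set.toFinite _)
end
end

section
/- Let C be the Z₂[x]-submodule of R_{r,s} generated by (b(x) | 0) and (ℓ(x) | a(x)), where b(x) divides x^r−1 and a(x) divides x^s−1. Then the canonical projection C_r of C onto the first factor Z₂[x]/(x^r−1) is the ideal generated by gcd(b(x), ℓ(x)), and the canonical projection C_s of C onto the second factor Z₂[x]/(x^s−1) is the ideal generated by a(x). -/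
open Polynomial

noncomputable section

/-- The canonical projection `mkQ n` as a `Z₂[x]`-linear map. -/
def mkQLinear (n : ℕ) : Z2P →ₗ[Z2P] Rq n where
  toFun := mkQ n
  map_add' := map_add (mkQ n)
  map_smul' p q := by
    rw [smul_eq_mul, map_mul]
    rfl

/-- The canonical projection commutes with the span of a set of polynomials. -/
theorem map_mkQLinear_span (n : ℕ) (S : Set Z2P) :
    Submodule.map (mkQLinear n) (Submodule.span Z2P S) = Submodule.span Z2P (mkQ n '' S) :=
  Submodule.map_span _ _

/-- For `C = ⟨(b | 0), (ℓ | a)⟩` with `b ∣ x^r−1` and `a ∣ x^s−1`, the projection `C_r` of `C`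
on the first factor is generated by `gcd(b, ℓ)` and the projection `C_s` on the second factor
is generated by `a`. -/
theorem stmt1 (r s : ℕ) (hr : 0 < r) (hs : 0 < s) (b l a : Z2P)
    (hb : b ∣ (X : Z2P) ^ r - 1) (ha : a ∣ (X : Z2P) ^ s - 1) :
    Submodule.map (LinearMap.fst Z2P (Rq r) (Rq s))
        (Submodule.span Z2P {((mkQ r b, 0) : Rq r × Rq s), (mkQ r l, mkQ s a)}) =
      Submodule.span Z2P {mkQ r (gcd b l)} ∧
    Submodule.map (LinearMap.snd Z2P (Rq r) (Rq s))
        (Submodule.span Z2P {((mkQ r b, 0) : Rq r × Rq s), (mkQ r l, mkQ s a)}) =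
      Submodule.span Z2P {mkQ s a} := by
  constructor
  · rw [Submodule.map_span, Set.image_pair]
    have hgcd : Submodule.span Z2P {gcd b l} = Submodule.span Z2P {b, l} := span_gcd b l
    have hsingle := map_mkQLinear_span r {gcd b l}
    rw [hgcd, map_mkQLinear_span, Set.image_singleton, Set.image_pair] at hsingle
    exact hsingle
  · rw [Submodule.map_span, Set.image_pair]
    exact Submodule.span_insert_zero
end
end

section
/- Let C = ⟨(b(x) | 0), (ℓ(x) | a(x))⟩ be a Z₂-double cyclic code, where b(x) divides x^r−1, a(x) divides x^s−1, and b(x) divides ((x^s−1)/a(x))·ℓ(x). Define S₁ = { x^i ⋆ (b(x) | 0) : 0 ≤ i ≤ r − deg b(x) − 1 } and S₂ = { x^j ⋆ (ℓ(x) | a(x)) : 0 ≤ j ≤ s − deg a(x) − 1 }. Then S₁ ∪ S₂ spans C as a Z₂-vector space, i.e., every element of C is a Z₂-linear combination of elements of S₁ ∪ S₂. -/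
open Polynomial

noncomputable section

theorem smul_mem_span_X_pow_smul {K M : Type*} [Field K] [AddCommGroup M] [Module K M]
    [Module K[X] M] [IsScalarTower K K[X] M] (v : M) {g : K[X]} {n : ℕ} (hg : g.degree < n) :
    g • v ∈ Submodule.span K ((fun i : ℕ => (X : K[X]) ^ i • v) '' Set.Iio n) := by
  rw [g.as_sum_range_C_mul_X_pow, Finset.sum_smul]
  refine Submodule.sum_mem _ fun i _ => ?_
  rw [← smul_eq_C_mul, smul_assoc]
  by_cases hi : i < n
  · exact Submodule.smul_mem _ _ (Submodule.subset_span ⟨i, hi, rfl⟩)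
  · rw [coeff_eq_zero_of_degree_lt (hg.trans_le (by exact_mod_cast not_lt.mp hi)), zero_smul]
    exact Submodule.zero_mem _

/-- Division with remainder by `f` reduces membership of `g • v` to membership of
multiples of `f • v`. -/
theorem smul_mem_of_forall_smul_mem {K M : Type*} [Field K] [AddCommGroup M] [Module K M]
    [Module K[X] M] [IsScalarTower K K[X] M] {v : M} {f : K[X]} (hf : f ≠ 0)
    {W : Submodule K M} (hW : ∀ q : K[X], q • f • v ∈ W)
    (hv : (fun i : ℕ => (X : K[X]) ^ i • v) '' Set.Iio f.natDegree ⊆ W) (g : K[X]) :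
    g • v ∈ W := by
  rw [← EuclideanDomain.div_add_mod g f, add_smul, mul_comm, mul_smul]
  refine add_mem (hW _) (Submodule.span_le.mpr hv (smul_mem_span_X_pow_smul v ?_))
  rw [← degree_eq_natDegree hf]
  exact EuclideanDomain.mod_lt g hf

theorem natDegree_cofactor_X_pow_sub_one {K : Type*} [Field K] {n : ℕ} (hn : 0 < n)
    {p q : K[X]} (h : (X : K[X]) ^ n - 1 = p * q) :
    p ≠ 0 ∧ q ≠ 0 ∧ q.natDegree = n - p.natDegree := by
  have h0 : p * q ≠ 0 := h ▸ X_pow_sub_C_ne_zero hn (1 : K)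
  obtain ⟨hp, hq⟩ := mul_ne_zero_iff.mp h0
  have hd := natDegree_X_pow_sub_C (R := K) (n := n) (r := 1)
  rw [C_1, h, natDegree_mul hp hq] at hd
  exact ⟨hp, hq, by omega⟩

theorem smul_mkQ (n : ℕ) (p q : Z2P) : p • mkQ n q = mkQ n (p * q) := rfl

theorem mkQ_X_pow_sub_one (n : ℕ) : mkQ n (X ^ n - 1) = 0 :=
  Ideal.Quotient.eq_zero_iff_mem.mpr (Ideal.mem_span_singleton_self _)

/-- For `C = ⟨(b | 0), (ℓ | a)⟩` with `b ∣ x^r−1`, `a ∣ x^s−1` and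
`b ∣ ((x^s−1)/a)·ℓ`, the set
`S₁ ∪ S₂ = {x^i ⋆ (b | 0) : 0 ≤ i ≤ r − deg b − 1} ∪ {x^j ⋆ (ℓ | a) : 0 ≤ j ≤ s − deg a − 1}`
spans `C` as a `Z₂`-vector space. -/
theorem stmt2 (r s : ℕ) (hr : 0 < r) (hs : 0 < s) (b l a : Z2P)
    (hb : b ∣ (X : Z2P) ^ r - 1) (ha : a ∣ (X : Z2P) ^ s - 1)
    (hbl : b ∣ (((X : Z2P) ^ s - 1) / a) * l) :
    (Submodule.span Z2P {((mkQ r b, 0) : Rq r × Rq s), (mkQ r l, mkQ s a)} : Set (Rq r × Rq s))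
      ⊆ Submodule.span (ZMod 2)
        (((fun i : ℕ => ((X : Z2P) ^ i) • ((mkQ r b, 0) : Rq r × Rq s)) ''
            Set.Iio (r - b.natDegree)) ∪
         ((fun j : ℕ => ((X : Z2P) ^ j) • ((mkQ r l, mkQ s a) : Rq r × Rq s)) ''
            Set.Iio (s - a.natDegree))) := by
  obtain ⟨b', hb'⟩ := hb
  obtain ⟨a', ha'⟩ := ha
  obtain ⟨-, hb0, hbd⟩ := natDegree_cofactor_X_pow_sub_one hr hb'
  obtain ⟨ha0, ha0', had⟩ := natDegree_cofactor_X_pow_sub_one hs ha'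
  rw [ha', mul_div_cancel_left₀ a' ha0] at hbl
  obtain ⟨c, hc⟩ := hbl
  rw [← hbd, ← had]
  set W := Submodule.span (ZMod 2)
    (((fun i : ℕ => ((X : Z2P) ^ i) • ((mkQ r b, 0) : Rq r × Rq s)) '' Set.Iio b'.natDegree) ∪
      ((fun j : ℕ => ((X : Z2P) ^ j) • ((mkQ r l, mkQ s a) : Rq r × Rq s)) ''
        Set.Iio a'.natDegree))
  have hfst : ∀ g : Z2P, g • ((mkQ r b, 0) : Rq r × Rq s) ∈ W := by
    refine smul_mem_of_forall_smul_mem hb0 (fun q => ?_)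
      (Set.subset_union_left.trans Submodule.subset_span)
    have h : b' • ((mkQ r b, 0) : Rq r × Rq s) = 0 := by
      rw [Prod.smul_mk, smul_mkQ, mul_comm, ← hb', mkQ_X_pow_sub_one, smul_zero,
        Prod.mk_zero_zero]
    rw [h, smul_zero]
    exact zero_mem W
  have hsnd : ∀ g : Z2P, g • ((mkQ r l, mkQ s a) : Rq r × Rq s) ∈ W := by
    refine smul_mem_of_forall_smul_mem ha0' (fun q => ?_)
      (Set.subset_union_right.trans Submodule.subset_span)
    have h : a' • ((mkQ r l, mkQ s a) : Rq r × Rq s) = c • (mkQ r b, 0) := by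
      rw [Prod.smul_mk, Prod.smul_mk, smul_mkQ, smul_mkQ, smul_mkQ, hc, mul_comm a' a, ← ha',
        mkQ_X_pow_sub_one, smul_zero, mul_comm]
    rw [h, ← mul_smul]
    exact hfst _
  intro x hx
  obtain ⟨g, h, rfl⟩ := Submodule.mem_span_pair.mp hx
  exact add_mem (hfst g) (hsnd h)
end
end

section
/- Let C = ⟨(b(x) | 0), (ℓ(x) | a(x))⟩ be a Z₂-double cyclic code, where b(x) divides x^r−1 and a(x) divides x^s−1. Then there exists a polynomial ℓ'(x) with deg ℓ'(x) < deg b(x) such that C = ⟨(b(x) | 0), (ℓ'(x) | a(x))⟩. -/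
open Polynomial

noncomputable section

/-- Replacing a generator by its sum with a multiple of the other does not change the span. -/
theorem Submodule.span_pair_add_smul {R M : Type*} [Ring R] [AddCommGroup M] [Module R M]
    (u v : M) (c : R) : Submodule.span R {u, v + c • u} = Submodule.span R {u, v} := by
  apply le_antisymm <;> rw [Submodule.span_le, Set.pair_subset_iff] <;>
    refine ⟨Submodule.mem_span_pair.2 ⟨1, 0, by simp⟩, Submodule.mem_span_pair.2 ?_⟩
  · exact ⟨c, 1, by rw [one_smul, add_comm]⟩
  · exact ⟨-c, 1, by rw [one_smul, neg_smul]; abel⟩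

/-- For `C = ⟨(b | 0), (ℓ | a)⟩` with `b ∣ x^r−1` and `a ∣ x^s−1`, there is a polynomial `ℓ'`
with `deg ℓ' < deg b` such that `C = ⟨(b | 0), (ℓ' | a)⟩`. -/
theorem stmt4 (r s : ℕ) (hr : 0 < r) (hs : 0 < s) (b l a : Z2P)
    (hb : b ∣ (X : Z2P) ^ r - 1) (ha : a ∣ (X : Z2P) ^ s - 1) :
    ∃ l' : Z2P, l'.degree < b.degree ∧
      Submodule.span Z2P {((mkQ r b, 0) : Rq r × Rq s), (mkQ r l', mkQ s a)} =
      Submodule.span Z2P {((mkQ r b, 0) : Rq r × Rq s), (mkQ r l, mkQ s a)} := by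
  have hb0 : b ≠ 0 := ne_zero_of_dvd_ne_zero (X_pow_sub_C_ne_zero hr 1) (by simpa using hb)
  refine ⟨l % b, EuclideanDomain.mod_lt l hb0, ?_⟩
  rw [← Submodule.span_pair_add_smul _ (mkQ r (l % b), mkQ s a) (l / b)]
  have hl : mkQ r l = mkQ r (l % b) + (l / b) • mkQ r b := by
    conv_lhs => rw [← EuclideanDomain.mod_add_div l b, mul_comm, map_add]
    rfl
  rw [hl, Prod.smul_mk, smul_zero, Prod.mk_add_mk, add_zero]
end
end

section
/- Let C = ⟨(b(x) | 0), (ℓ(x) | a(x))⟩ be a Z₂-double cyclic code, where b(x) divides x^r−1, a(x) divides x^s−1, the subcode {(p(x) | 0) ∈ C} equals ⟨(b(x) | 0)⟩, and a(x) generates the projection C_s of C on the second factor. Then b(x) divides the polynomial ((x^s−1)/a(x)) · ℓ(x) in Z₂[x]. -/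
open Polynomial

noncomputable section

/-- Let `C = ⟨(b | 0), (ℓ | a)⟩` with `b ∣ x^r−1`, `a ∣ x^s−1`, such that the subcode
`{(p | 0) ∈ C}` equals `⟨(b | 0)⟩` and `a` generates the projection `C_s`.
Then `b ∣ ((x^s−1)/a)·ℓ` in `Z₂[x]`. -/
theorem stmt5 (r s : ℕ) (hr : 0 < r) (hs : 0 < s) (b l a : Z2P)
    (hb : b ∣ (X : Z2P) ^ r - 1) (ha : a ∣ (X : Z2P) ^ s - 1)
    (hker : Submodule.span Z2P {((mkQ r b, 0) : Rq r × Rq s), (mkQ r l, mkQ s a)} ⊓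
        LinearMap.ker (LinearMap.snd Z2P (Rq r) (Rq s)) =
      Submodule.span Z2P {((mkQ r b, 0) : Rq r × Rq s)})
    (hCs : Submodule.map (LinearMap.snd Z2P (Rq r) (Rq s))
        (Submodule.span Z2P {((mkQ r b, 0) : Rq r × Rq s), (mkQ r l, mkQ s a)}) =
      Submodule.span Z2P {mkQ s a}) :
    b ∣ (((X : Z2P) ^ s - 1) / a) * l := by
  set q := ((X : Z2P) ^ s - 1) / a
  have hqa : q * a = X ^ s - 1 := by
    rw [mul_comm]
    exact EuclideanDomain.mul_div_cancel' (ne_zero_of_dvd_ne_zero (X_pow_sub_C_ne_zero hs 1) ha) ha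
  have hsmul (n : ℕ) (p f : Z2P) : p • mkQ n f = mkQ n (p * f) := rfl
  have hzero : mkQ s (q * a) = 0 := by
    rw [hqa]
    exact Ideal.Quotient.eq_zero_iff_mem.2 (Ideal.mem_span_singleton_self _)
  have hmem : ((mkQ r (q * l), 0) : Rq r × Rq s) ∈
      Submodule.span Z2P {((mkQ r b, 0) : Rq r × Rq s)} := by
    rw [← hker]
    refine ⟨?_, by simp⟩
    have h := Submodule.smul_mem
      (Submodule.span Z2P {((mkQ r b, 0) : Rq r × Rq s), (mkQ r l, mkQ s a)}) q
      (Submodule.subset_span (Set.mem_insert_of_mem _ rfl))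
    rwa [Prod.smul_mk, hsmul, hsmul, hzero] at h
  obtain ⟨c, hc⟩ := Submodule.mem_span_singleton.1 hmem
  have hfst : mkQ r (c * b) = mkQ r (q * l) := congrArg Prod.fst hc
  have hdvd : (X : Z2P) ^ r - 1 ∣ c * b - q * l :=
    Ideal.mem_span_singleton.1 (Ideal.Quotient.eq.1 hfst)
  exact (dvd_sub_right (dvd_mul_left b c)).1 (hb.trans hdvd)
end
end

section
/- Let C ⊆ Z₂^r × Z₂^s be a Z₂-double cyclic code, i.e., a binary linear code such that whenever (u₀,…,u_{r−1} | u'₀,…,u'_{s−1}) ∈ C, also (u_{r−1},u₀,…,u_{r−2} | u'_{s−1},u'₀,…,u'_{s−2}) ∈ C. Then the dual code C^⊥ = { v ∈ Z₂^r × Z₂^s : u·v = 0 for all u ∈ C }, where · is the standard inner product on Z₂^{r+s}, is also a Z₂-double cyclic code. -/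
noncomputable section

/-- The simultaneous cyclic shift on `Z₂^r × Z₂^s`: it sends
`(u₀,…,u_{r−1} | u'₀,…,u'_{s−1})` to `(u_{r−1},u₀,…,u_{r−2} | u'_{s−1},u'₀,…,u'_{s−2})`. -/
def doubleShift {r s : ℕ} [NeZero r] [NeZero s]
    (u : (Fin r → ZMod 2) × (Fin s → ZMod 2)) : (Fin r → ZMod 2) × (Fin s → ZMod 2) :=
  (fun i => u.1 (i - 1), fun j => u.2 (j - 1))

theorem doubleShift_injective {r s : ℕ} [NeZero r] [NeZero s] :
    Function.Injective (doubleShift (r := r) (s := s)) := by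
  intro u v h
  ext i
  · simpa [doubleShift] using congrFun (congrArg Prod.fst h) (i + 1)
  · simpa [doubleShift] using congrFun (congrArg Prod.snd h) (i + 1)

/-- A binary linear code closed under the simultaneous shift is also closed under its inverse. -/
theorem exists_doubleShift_eq {r s : ℕ} [NeZero r] [NeZero s]
    {C : Submodule (ZMod 2) ((Fin r → ZMod 2) × (Fin s → ZMod 2))}
    (hC : ∀ u ∈ C, doubleShift u ∈ C)
    {u : (Fin r → ZMod 2) × (Fin s → ZMod 2)} (hu : u ∈ C) :
    ∃ w ∈ C, doubleShift w = u := by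
  have hmaps : Set.MapsTo (doubleShift (r := r) (s := s)) C C := hC
  obtain ⟨w, hw⟩ := Finite.surjective_of_injective
    (hmaps.restrict_inj.2 doubleShift_injective.injOn) ⟨u, hu⟩
  exact ⟨w, w.2, congrArg Subtype.val hw⟩

theorem sum_mul_shift {n : ℕ} [NeZero n] (a b : Fin n → ZMod 2) :
    ∑ i, a (i - 1) * b (i - 1) = ∑ i, a i * b i :=
  Equiv.sum_comp (Equiv.subRight (1 : Fin n)) fun i => a i * b i

/-- If `C ⊆ Z₂^r × Z₂^s` is a `Z₂`-double cyclic code (a binary linear code closed under the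
simultaneous shift), then its dual code `C^⊥` (with respect to the standard inner product on
`Z₂^{r+s}`) is also a `Z₂`-double cyclic code. -/
theorem stmt8 (r s : ℕ) [NeZero r] [NeZero s]
    (C : Submodule (ZMod 2) ((Fin r → ZMod 2) × (Fin s → ZMod 2)))
    (hC : ∀ u ∈ C, doubleShift u ∈ C) :
    ∃ D : Submodule (ZMod 2) ((Fin r → ZMod 2) × (Fin s → ZMod 2)),
      (D : Set ((Fin r → ZMod 2) × (Fin s → ZMod 2))) =
        {v | ∀ u ∈ C, (∑ i, u.1 i * v.1 i) + (∑ j, u.2 j * v.2 j) = 0} ∧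
      ∀ v ∈ D, doubleShift v ∈ D := by
  refine ⟨{ carrier := {v | ∀ u ∈ C, (∑ i, u.1 i * v.1 i) + (∑ j, u.2 j * v.2 j) = 0}
            add_mem' := ?_, zero_mem' := ?_, smul_mem' := ?_ }, rfl, ?_⟩
  · intro v w hv hw u hu
    simp only [Prod.fst_add, Prod.snd_add, Pi.add_apply, mul_add, Finset.sum_add_distrib]
    linear_combination hv u hu + hw u hu
  · intro u _
    simp
  · intro c v hv u hu
    simp only [Prod.smul_fst, Prod.smul_snd, Pi.smul_apply, smul_eq_mul, mul_left_comm _ c,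
      ← Finset.mul_sum]
    linear_combination c * hv u hu
  · intro v hv u hu
    obtain ⟨w, hw, rfl⟩ := exists_doubleShift_eq hC hu
    simpa only [doubleShift, sum_mul_shift] using hv w hw
end
end

section
/- Let u = (u₀,…,u_{r−1} | u'₀,…,u'_{s−1}) and v = (v₀,…,v_{r−1} | v'₀,…,v'_{s−1}) be vectors in Z₂^r × Z₂^s with associated polynomial pairs u(x) = (u(x) | u'(x)) and v(x) = (v(x) | v'(x)). Then u is orthogonal (for the standard inner product on Z₂^{r+s}) to v and to every simultaneous shift v^{(i)} of v, for all i ≥ 0, if and only if u(x) ∘ v(x) = 0 in Z₂[x]/(x^𝔪 − 1). -/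
open Polynomial

noncomputable section

/-- `θ_m(x) = 1 + x + ⋯ + x^{m−1}`. -/
def theta (m : ℕ) : Z2P := ∑ i ∈ Finset.range m, (X : Z2P) ^ i

/-- The polynomial `Σ v_j x^j` associated to a vector `v ∈ Z₂^n`. -/
def polyOf (n : ℕ) (v : Fin n → ZMod 2) : Z2P :=
  ∑ i : Fin n, Polynomial.C (v i) * (X : Z2P) ^ (i : ℕ)

/-- The polynomial representative of `u(x) ∘ v(x)`, where `𝔪 = lcm(r,s)`:
`u(x)·θ_{𝔪/r}(x^r)·x^{𝔪−1−deg v(x)}·v*(x) + u'(x)·θ_{𝔪/s}(x^s)·x^{𝔪−1−deg v'(x)}·v'*(x)`,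
to be reduced modulo `x^𝔪 − 1`. Here `p* = reverse p` is the reciprocal polynomial. -/
def circPoly (r s : ℕ) (u u' v v' : Z2P) : Z2P :=
  u * (theta (Nat.lcm r s / r)).comp ((X : Z2P) ^ r) *
      (X : Z2P) ^ (Nat.lcm r s - 1 - v.natDegree) * v.reverse +
  u' * (theta (Nat.lcm r s / s)).comp ((X : Z2P) ^ s) *
      (X : Z2P) ^ (Nat.lcm r s - 1 - v'.natDegree) * v'.reverse

/-- The `i`-th simultaneous shift reads both components `i` places back. -/
theorem doubleShift_iterate {r s : ℕ} [NeZero r] [NeZero s]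
    (v : (Fin r → ZMod 2) × (Fin s → ZMod 2)) (i : ℕ) :
    doubleShift^[i] v =
      (fun j => v.1 (j - Fin.ofNat r i), fun k => v.2 (k - Fin.ofNat s i)) := by
  have ofNat_succ (n : ℕ) [NeZero n] (i : ℕ) : Fin.ofNat n (i + 1) = 1 + Fin.ofNat n i := by
    apply Fin.ext
    simp [Fin.val_add, Fin.ofNat, add_comm]
  induction i with
  | zero => simp
  | succ i ih =>
    rw [Function.iterate_succ_apply', ih]
    simp only [doubleShift, ofNat_succ, sub_sub]

theorem coeff_polyOf (n : ℕ) (v : Fin n → ZMod 2) (k : ℕ) :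
    (polyOf n v).coeff k = if h : k < n then v ⟨k, h⟩ else 0 := by
  simp only [polyOf, finsetSum_coeff, coeff_C_mul_X_pow]
  split_ifs with h
  · rw [Finset.sum_eq_single ⟨k, h⟩]
    · simp
    · intro b _ hb
      rw [if_neg]
      rintro rfl
      exact hb rfl
    · simp
  · refine Finset.sum_eq_zero fun b _ => if_neg ?_
    have := b.2
    omega

theorem X_pow_mul_reverse_polyOf {n m : ℕ} (hnm : n ≤ m) (v : Fin n → ZMod 2) :
    (X : Z2P) ^ (m - 1 - (polyOf n v).natDegree) * (polyOf n v).reverse =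
      ∑ k : Fin n, C (v k) * X ^ (m - 1 - (k : ℕ)) := by
  have hdeg : (polyOf n v).natDegree ≤ n - 1 := by
    refine natDegree_le_iff_coeff_eq_zero.2 fun k hk => ?_
    rw [coeff_polyOf, dif_neg (by omega)]
  have hrefl : (X : Z2P) ^ (m - 1 - (polyOf n v).natDegree) * (polyOf n v).reverse =
      reflect (m - 1) (polyOf n v) := by
    have := reflect_mul (polyOf n v) (1 : Z2P) (F := (polyOf n v).natDegree)
      (G := m - 1 - (polyOf n v).natDegree) le_rfl (by simp)
    rw [mul_one, Nat.add_sub_cancel' (by omega), reflect_one] at this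
    rw [this, mul_comm, reverse]
  have hsum (N : ℕ) (t : Finset (Fin n)) (f : Fin n → Z2P) :
      reflect N (∑ k ∈ t, f k) = ∑ k ∈ t, reflect N (f k) := by
    induction t using Finset.induction_on with
    | empty => simp
    | insert a t ha ih => rw [Finset.sum_insert ha, Finset.sum_insert ha, reflect_add, ih]
  rw [hrefl, polyOf, hsum]
  refine Finset.sum_congr rfl fun k _ => ?_
  rw [reflect_C_mul_X_pow, revAt_le (by omega)]

/-- A geometric sum `∑ x ^ (r t)` over a full period absorbs `x ^ r`. -/
theorem pow_mul_geom_sum_congr {A : Type*} [CommRing A] {x : A} {r m : ℕ} (hrm : r ∣ m)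
    (hx : x ^ m = 1) {a b : ℕ} (hab : a ≡ b [MOD r]) :
    x ^ a * ∑ t ∈ Finset.range (m / r), (x ^ r) ^ t =
      x ^ b * ∑ t ∈ Finset.range (m / r), (x ^ r) ^ t := by
  set T := ∑ t ∈ Finset.range (m / r), (x ^ r) ^ t
  have hT : x ^ r * T = T := by
    have := mul_geom_sum (x ^ r) (m / r)
    rw [← pow_mul, Nat.mul_div_cancel' hrm, hx, sub_self, sub_mul, one_mul] at this
    exact sub_eq_zero.1 this
  have hTq (q : ℕ) : x ^ (r * q) * T = T := by
    induction q with
    | zero => simp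
    | succ q ih => rw [mul_add_one, pow_add, mul_assoc, hT, ih]
  have hmod (c : ℕ) : x ^ c * T = x ^ (c % r) * T := by
    conv_lhs => rw [← Nat.mod_add_div c r, pow_add, mul_assoc, hTq]
  rw [hmod a, hmod b, hab]

/-- One component of `u(x) ∘ v(x)`, multiplied by `x`, is the generating function of the inner
products of `u` with the shifts of `v`. -/
theorem mul_aeval_component {A : Type*} [CommRing A] [Algebra (ZMod 2) A] {x : A} {r m : ℕ}
    [NeZero r] (hm : m ≠ 0) (hrm : r ∣ m) (hx : x ^ m = 1) (u v : Fin r → ZMod 2) :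
    x * aeval x (polyOf r u * (theta (m / r)).comp ((X : Z2P) ^ r) *
        (X : Z2P) ^ (m - 1 - (polyOf r v).natDegree) * (polyOf r v).reverse) =
      ∑ e ∈ Finset.range m,
        algebraMap (ZMod 2) A (∑ j, u j * v (j - Fin.ofNat r e)) * x ^ e := by
  have hle : r ≤ m := Nat.le_of_dvd (Nat.pos_of_ne_zero hm) hrm
  set T := ∑ t ∈ Finset.range (m / r), (x ^ r) ^ t with hT
  have hsplit (f : Fin r → A) :
      ∑ e ∈ Finset.range m, f (Fin.ofNat r e) * x ^ e = ∑ k, f k * (x ^ (k : ℕ) * T) := by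
    conv_lhs => rw [← Nat.div_mul_cancel hrm, Finset.sum_range, ← finProdFinEquiv.sum_comp,
      Fintype.sum_prod_type, Finset.sum_comm]
    refine Finset.sum_congr rfl fun k _ => ?_
    rw [hT, Finset.sum_range, Finset.mul_sum, Finset.mul_sum]
    refine Finset.sum_congr rfl fun t _ => ?_
    have : Fin.ofNat r (finProdFinEquiv (t, k) : ℕ) = k := by
      apply Fin.ext
      simp [Fin.ofNat, Nat.mod_eq_of_lt k.2]
    rw [this, finProdFinEquiv_apply_val, pow_add, pow_mul]
  have htheta : aeval x ((theta (m / r)).comp ((X : Z2P) ^ r)) = T := by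
    simp [theta, hT]
  rw [mul_assoc, X_pow_mul_reverse_polyOf hle, map_mul, map_mul, htheta]
  simp only [map_sum, map_mul, Finset.sum_mul]
  rw [Finset.sum_comm]
  simp only [polyOf, map_sum, map_mul, aeval_C, map_pow, aeval_X, Finset.sum_mul, Finset.mul_sum]
  rw [Finset.sum_comm]
  refine Finset.sum_congr rfl fun j _ => ?_
  rw [hsplit fun k => algebraMap (ZMod 2) A (u j) * algebraMap (ZMod 2) A (v (j - k))]
  refine Eq.trans ?_ ((Equiv.subLeft j).sum_comp _)
  refine Finset.sum_congr rfl fun k _ => ?_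
  have hmod : (j : ℕ) + (m - k) ≡ ((j - k : Fin r) : ℕ) [MOD r] := by
    obtain ⟨q, rfl⟩ := hrm
    obtain _ | q := q
    · simp at hm
    rw [Fin.sub_def, Nat.ModEq, Nat.mod_mod, mul_add_one,
      show (j : ℕ) + (r * q + r - k) = (r - k + j) + r * q by omega, Nat.add_mul_mod_self_left]
  have hexp : x ^ (m - (k : ℕ)) = x * x ^ (m - 1 - (k : ℕ)) := by
    rw [← pow_succ', show m - 1 - (k : ℕ) + 1 = m - k by omega]
  have key := pow_mul_geom_sum_congr hrm hx hmod
  rw [pow_add, hexp, ← hT] at key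
  simp only [Equiv.subLeft_apply, sub_sub_cancel]
  rw [← key]
  ring

/-- A polynomial of degree less than `m` is divisible by `X ^ m - 1` only if it vanishes. -/
theorem X_pow_sub_one_dvd_sum_iff {m : ℕ} (hm : m ≠ 0) (S : ℕ → ZMod 2) :
    ((X : Z2P) ^ m - 1) ∣ ∑ e ∈ Finset.range m, C (S e) * X ^ e ↔ ∀ e < m, S e = 0 := by
  constructor
  · intro h e he
    have hmonic : ((X : Z2P) ^ m - 1).Monic := by
      simpa using monic_X_pow_sub_C (1 : ZMod 2) hm
    have hdeg : (∑ e ∈ Finset.range m, C (S e) * (X : Z2P) ^ e).degree <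
        ((X : Z2P) ^ m - 1).degree := by
      rw [← C_1, degree_X_pow_sub_C (Nat.pos_of_ne_zero hm)]
      refine (degree_sum_le _ _).trans_lt ((Finset.sup_lt_iff (WithBot.bot_lt_coe m)).2 ?_)
      intro b hb
      exact (degree_C_mul_X_pow_le b _).trans_lt (WithBot.coe_lt_coe.2 (Finset.mem_range.1 hb))
    have hzero : (∑ e ∈ Finset.range m, C (S e) * (X : Z2P) ^ e) = 0 := by
      by_contra hne
      exact hmonic.not_dvd_of_degree_lt hne hdeg h
    have := congrArg (fun p => coeff p e) hzero
    simpa [finsetSum_coeff, coeff_X_pow, he] using this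
  · intro h
    rw [Finset.sum_eq_zero fun e he => by rw [h e (Finset.mem_range.1 he), C_0, zero_mul]]
    exact dvd_zero _

/-- Let `u, v ∈ Z₂^r × Z₂^s` with associated polynomial pairs `(u(x) | u'(x))` and
`(v(x) | v'(x))`. Then `u` is orthogonal to `v` and to every simultaneous shift `v^{(i)}` of
`v` (for all `i ≥ 0`) if and only if `u(x) ∘ v(x) = 0` in `Z₂[x]/(x^𝔪 − 1)`, `𝔪 = lcm(r,s)`. -/
theorem stmt9 (r s : ℕ) [NeZero r] [NeZero s]
    (u v : (Fin r → ZMod 2) × (Fin s → ZMod 2)) :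
    (∀ i : ℕ,
        (∑ j, u.1 j * (doubleShift^[i] v).1 j) + (∑ k, u.2 k * (doubleShift^[i] v).2 k) = 0)
      ↔ ((X : Z2P) ^ (Nat.lcm r s) - 1) ∣
          circPoly r s (polyOf r u.1) (polyOf s u.2) (polyOf r v.1) (polyOf s v.2) := by
  set m := Nat.lcm r s with hm_def
  have hm : m ≠ 0 := Nat.lcm_ne_zero (NeZero.ne r) (NeZero.ne s)
  set S : ℕ → ZMod 2 := fun e =>
    (∑ j, u.1 j * v.1 (j - Fin.ofNat r e)) + ∑ k, u.2 k * v.2 (k - Fin.ofNat s e) with hS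
  set f : Z2P := X ^ m - 1 with hf
  set x := AdjoinRoot.root f
  have hx : x ^ m = 1 := by
    have : AdjoinRoot.mk f f = 0 := AdjoinRoot.mk_self
    rw [hf, map_sub, map_pow, map_one, sub_eq_zero] at this
    exact this
  have hS_mod (i : ℕ) : S i = S (i % m) := by
    have hr : Fin.ofNat r (i % m) = Fin.ofNat r i :=
      Fin.ext (Nat.mod_mod_of_dvd i (Nat.dvd_lcm_left r s))
    have hs : Fin.ofNat s (i % m) = Fin.ofNat s i :=
      Fin.ext (Nat.mod_mod_of_dvd i (Nat.dvd_lcm_right r s))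
    simp only [hS, hr, hs]
  have hcirc : x * aeval x
      (circPoly r s (polyOf r u.1) (polyOf s u.2) (polyOf r v.1) (polyOf s v.2)) =
      aeval x (∑ e ∈ Finset.range m, C (S e) * (X : Z2P) ^ e) := by
    rw [circPoly, map_add, mul_add, ← hm_def,
      mul_aeval_component hm (Nat.dvd_lcm_left r s) hx,
      mul_aeval_component hm (Nat.dvd_lcm_right r s) hx, ← Finset.sum_add_distrib]
    simp only [hS, map_sum, map_mul, map_add, aeval_C, map_pow, aeval_X, add_mul]
  have hunit : IsUnit x := IsUnit.of_pow_eq_one hx hm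
  rw [← AdjoinRoot.mk_eq_zero, ← AdjoinRoot.aeval_eq, ← hunit.mul_right_eq_zero, hcirc,
    AdjoinRoot.aeval_eq, AdjoinRoot.mk_eq_zero, hf, X_pow_sub_one_dvd_sum_iff hm]
  simp only [doubleShift_iterate]
  refine ⟨fun h e _ => h e, fun h i => ?_⟩
  exact (hS_mod i).trans (h _ (Nat.mod_lt i (Nat.pos_of_ne_zero hm)))
end
end

section
/- Let u(x) = (u(x) | u'(x)) and v(x) = (v(x) | v'(x)) be elements of R_{r,s} such that u(x) ∘ v(x) = 0 modulo x^𝔪 − 1. If u'(x) = 0 or v'(x) = 0, then u(x)·v*(x) = 0 modulo x^r − 1. Likewise, if u(x) = 0 or v(x) = 0, then u'(x)·v'*(x) = 0 modulo x^s − 1. -/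
open Polynomial

noncomputable section

theorem theta_comp_X_pow_mul (r k : ℕ) :
    (theta k).comp ((X : Z2P) ^ r) * ((X : Z2P) ^ r - 1) = (X : Z2P) ^ (r * k) - 1 := by
  simp only [theta, comp, eval₂_finsetSum, eval₂_X_pow]
  rw [geom_sum_mul, pow_mul]

theorem isCoprime_X_pow_sub_one_X_pow {r : ℕ} (hr : 0 < r) (k : ℕ) :
    IsCoprime ((X : Z2P) ^ r - 1) ((X : Z2P) ^ k) := by
  apply IsCoprime.pow_right
  obtain ⟨n, rfl⟩ := Nat.exists_eq_succ_of_ne_zero hr.ne'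
  exact ⟨-1, X ^ n, by rw [pow_succ]; ring⟩

theorem X_pow_sub_one_dvd_of_dvd_mul_theta {r m k : ℕ} (hr : 0 < r) (hm : 0 < m) (hrm : r ∣ m)
    {a b : Z2P}
    (h : ((X : Z2P) ^ m - 1) ∣ a * (theta (m / r)).comp ((X : Z2P) ^ r) * (X : Z2P) ^ k * b) :
    ((X : Z2P) ^ r - 1) ∣ a * b := by
  have hθ := theta_comp_X_pow_mul r (m / r)
  rw [Nat.mul_div_cancel' hrm] at hθ
  have hne : (theta (m / r)).comp ((X : Z2P) ^ r) ≠ 0 := by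
    intro h0
    rw [h0, zero_mul] at hθ
    exact X_pow_sub_C_ne_zero hm (1 : ZMod 2) (by simpa using hθ.symm)
  refine (isCoprime_X_pow_sub_one_X_pow hr k).dvd_of_dvd_mul_left ?_
  refine (mul_dvd_mul_iff_left hne).1 ?_
  rw [hθ]
  convert h using 1
  ring

/-- Let `(u | u')` and `(v | v')` be elements of `R_{r,s}` (represented by polynomials of
degree `< r` resp. `< s`) with `u(x) ∘ v(x) = 0 mod (x^𝔪 − 1)`.  If `u' = 0` or `v' = 0` then
`u·v* = 0 mod (x^r − 1)`; likewise if `u = 0` or `v = 0` then `u'·v'* = 0 mod (x^s − 1)`. -/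
theorem stmt10 (r s : ℕ) (hr : 0 < r) (hs : 0 < s) (u u' v v' : Z2P)
    (hu : u.natDegree < r) (hv : v.natDegree < r)
    (hu' : u'.natDegree < s) (hv' : v'.natDegree < s)
    (h : ((X : Z2P) ^ (Nat.lcm r s) - 1) ∣ circPoly r s u u' v v') :
    ((u' = 0 ∨ v' = 0) → ((X : Z2P) ^ r - 1) ∣ u * v.reverse) ∧
    ((u = 0 ∨ v = 0) → ((X : Z2P) ^ s - 1) ∣ u' * v'.reverse) := by
  have hm : 0 < Nat.lcm r s := Nat.lcm_pos hr hs
  unfold circPoly at h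
  constructor
  · rintro (rfl | rfl) <;>
      exact X_pow_sub_one_dvd_of_dvd_mul_theta hr hm (Nat.dvd_lcm_left r s) (by simpa using h)
  · rintro (rfl | rfl) <;>
      exact X_pow_sub_one_dvd_of_dvd_mul_theta hs hm (Nat.dvd_lcm_right r s) (by simpa using h)
end
end

section
/- Let C = ⟨(b(x) | 0), (ℓ(x) | a(x))⟩ be a Z₂-double cyclic code with b(x) | x^r−1, a(x) | x^s−1, the subcode {(p(x) | 0) ∈ C} equal to ⟨(b(x) | 0)⟩, and a(x) generating C_s. Write its dual as C^⊥ = ⟨(b̄(x) | 0), (ℓ̄(x) | ā(x))⟩ where b̄(x) | x^r−1, ā(x) | x^s−1, the subcode {(p(x) | 0) ∈ C^⊥} equals ⟨(b̄(x) | 0)⟩, and ā(x) generates (C^⊥)_s. Then deg ā(x) = s − deg a(x) − deg b(x) + deg gcd(b(x), ℓ(x)). -/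
open Polynomial

noncomputable section

/-- The element of `Z₂[x]/(x^n − 1)` associated to a vector `v ∈ Z₂^n` via coefficients. -/
def ofVec (n : ℕ) (v : Fin n → ZMod 2) : Rq n :=
  mkQ n (∑ i : Fin n, Polynomial.C (v i) * (X : Z2P) ^ (i : ℕ))

/-- The dual code `C^⊥` of a `Z₂`-double cyclic code `C ⊆ R_{r,s}`, computed with respect to
the standard inner product on `Z₂^{r+s}` under the coefficient identification
`R_{r,s} ≅ Z₂^r × Z₂^s`. -/
def dualCode (r s : ℕ) (C : Submodule Z2P (Rq r × Rq s)) : Set (Rq r × Rq s) :=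
  {c | ∃ w : (Fin r → ZMod 2) × (Fin s → ZMod 2),
        (ofVec r w.1, ofVec s w.2) = c ∧
        ∀ u : (Fin r → ZMod 2) × (Fin s → ZMod 2),
          (ofVec r u.1, ofVec s u.2) ∈ C →
          (∑ i, u.1 i * w.1 i) + (∑ j, u.2 j * w.2 j) = 0}

section LinearAlgebra

open Module LinearMap

variable {K V W : Type*} [Field K] [AddCommGroup V] [Module K V] [AddCommGroup W] [Module K W]

theorem Submodule.finrank_map_add_finrank_inf_ker [FiniteDimensional K V] (f : V →ₗ[K] W)
    (P : Submodule K V) : finrank K (P.map f) + finrank K (P ⊓ ker f : Submodule K V) =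
      finrank K P := by
  have h := (f.domRestrict P).finrank_range_add_finrank_ker
  have hker : (ker (f.domRestrict P)).map P.subtype = P ⊓ ker f := by
    rw [ker_domRestrict, Submodule.map_comap_subtype]
  rwa [range_domRestrict, ← Submodule.finrank_map_subtype_eq, hker] at h

/-- For nondegenerate forms on `V` and `W`, the second projection of the orthogonal complement `D`
of a subspace `P` of `V × W` has dimension `dim W + dim (fst P) - dim P`. -/
theorem finrank_map_snd_orthogonal [FiniteDimensional K V] [FiniteDimensional K W]
    {B : LinearMap.BilinForm K V} {B' : LinearMap.BilinForm K W}
    (hB : B.Nondegenerate) (hB' : B'.Nondegenerate) {P D : Submodule K (V × W)}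
    (hD : ∀ c, c ∈ D ↔ ∀ u ∈ P, B u.1 c.1 + B' u.2 c.2 = 0) :
    finrank K (D.map (snd K V W)) + finrank K P = finrank K W + finrank K (P.map (fst K V W)) := by
  let BB : LinearMap.BilinForm K (V × W) :=
    B.compl₁₂ (fst K V W) (fst K V W) + B'.compl₁₂ (snd K V W) (snd K V W)
  have hBB : BB.Nondegenerate := by
    constructor
    · intro x hx
      exact Prod.ext (hB.1 _ fun y => by simpa [BB] using hx (y, 0))
        (hB'.1 _ fun y => by simpa [BB] using hx (0, y))
    · intro x hx
      exact Prod.ext (hB.2 _ fun y => by simpa [BB] using hx (y, 0))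
        (hB'.2 _ fun y => by simpa [BB] using hx (0, y))
  have hDorth : D = BB.orthogonal P := by
    ext c
    simp [hD, LinearMap.BilinForm.mem_orthogonal_iff, BB]
  have hker : D ⊓ ker (snd K V W) = (B.orthogonal (P.map (fst K V W))).map (inl K V W) := by
    ext ⟨v, w⟩
    simp only [Submodule.mem_inf, hD, mem_ker, snd_apply, Submodule.mem_map, inl_apply,
      LinearMap.BilinForm.mem_orthogonal_iff, fst_apply, Prod.mk.injEq]
    constructor
    · rintro ⟨h, rfl⟩
      refine ⟨v, ?_, rfl, rfl⟩
      rintro _ ⟨u, hu, rfl⟩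
      simpa using h u hu
    · rintro ⟨v, h, rfl, rfl⟩
      refine ⟨fun u hu => ?_, rfl⟩
      simpa using h _ ⟨u, hu, rfl⟩
  have h1 := D.finrank_map_add_finrank_inf_ker (snd K V W)
  rw [hker, ← (Submodule.equivMapOfInjective _ inl_injective _).finrank_eq, hDorth,
    LinearMap.BilinForm.finrank_orthogonal hBB, LinearMap.BilinForm.finrank_orthogonal hB,
    finrank_prod, ← hDorth] at h1
  have h2 := P.finrank_le
  have h3 := (P.map (fst K V W)).finrank_le
  rw [finrank_prod] at h2
  lia

end LinearAlgebra

section CyclicCode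

open Module LinearMap

variable {n : ℕ}

theorem monic_X_pow_sub_one (hn : 0 < n) : ((X : Z2P) ^ n - 1).Monic := by
  simpa using monic_X_pow_sub_C (1 : ZMod 2) hn.ne'

theorem natDegree_X_pow_sub_one : ((X : Z2P) ^ n - 1).natDegree = n := by
  simpa using natDegree_X_pow_sub_C (n := n) (r := (1 : ZMod 2))

theorem finite_Rq (hn : 0 < n) : Module.Finite (ZMod 2) (Rq n) :=
  (monic_X_pow_sub_one hn).finite_quotient

theorem finrank_Rq : finrank (ZMod 2) (Rq n) = n := by
  rw [finrank_quotient_span_eq_natDegree, natDegree_X_pow_sub_one]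

/-- The identification `Z₂^n ≃ Z₂[x]/(x^n - 1)` via coefficients. -/
def ofVecEquiv (hn : 0 < n) : (Fin n → ZMod 2) ≃ₗ[ZMod 2] Rq n :=
  (LinearEquiv.funCongrLeft (ZMod 2) (ZMod 2)
      (finCongr (natDegree_X_pow_sub_one (n := n)))) ≪≫ₗ
    (AdjoinRoot.powerBasis' (monic_X_pow_sub_one hn)).basis.equivFun.symm

theorem ofVecEquiv_apply (hn : 0 < n) (v : Fin n → ZMod 2) : ofVecEquiv hn v = ofVec n v := by
  rw [ofVec, ← (finCongr (natDegree_X_pow_sub_one (n := n))).sum_comp]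
  simp only [C_mul_X_pow_eq_monomial]
  rfl

/-- The standard inner product on `Z₂^n`, transported to `Z₂[x]/(x^n - 1)`. -/
def innerRq (hn : 0 < n) : LinearMap.BilinForm (ZMod 2) (Rq n) :=
  (dotProductBilin (ZMod 2) (ZMod 2)).compl₁₂ (ofVecEquiv hn).symm.toLinearMap
    (ofVecEquiv hn).symm.toLinearMap

theorem innerRq_ofVec (hn : 0 < n) (v w : Fin n → ZMod 2) :
    innerRq hn (ofVec n v) (ofVec n w) = ∑ i, v i * w i := by
  simp [innerRq, ← ofVecEquiv_apply hn, dotProduct]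

theorem innerRq_nondegenerate (hn : 0 < n) : (innerRq hn).Nondegenerate := by
  refine ⟨fun x hx => ?_, fun x hx => ?_⟩
  all_goals
    rw [← (ofVecEquiv hn).symm.map_eq_zero_iff]
    ext i
    simpa [innerRq] using hx (ofVecEquiv hn (Pi.single i 1))

theorem finrank_span_mkQ (hn : 0 < n) {g : Z2P} (hg : g ∣ (X : Z2P) ^ n - 1) :
    finrank (ZMod 2) ((Submodule.span Z2P {mkQ n g}).restrictScalars (ZMod 2)) + g.natDegree =
      n := by
  have := finite_Rq hn
  have hle : Ideal.span {(X : Z2P) ^ n - 1} ≤ Ideal.span {g} := by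
    rwa [Ideal.span_singleton_le_span_singleton]
  let f : Rq n →ₗ[ZMod 2] Z2P ⧸ Ideal.span {g} := (Ideal.Quotient.factorₐ (ZMod 2) hle).toLinearMap
  have hf : Function.Surjective f := Ideal.Quotient.factor_surjective hle
  have hker : ker f = (Submodule.span Z2P {mkQ n g}).restrictScalars (ZMod 2) := by
    ext q
    obtain ⟨p, rfl⟩ := Ideal.Quotient.mk_surjective q
    have hfp : f (Ideal.Quotient.mk _ p) = Ideal.Quotient.mk (Ideal.span {g}) p := rfl
    rw [mem_ker, hfp, Ideal.Quotient.eq_zero_iff_mem, Ideal.mem_span_singleton,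
      Submodule.restrictScalars_mem, Submodule.mem_span_singleton]
    constructor
    · rintro ⟨c, rfl⟩
      exact ⟨c, by rw [mul_comm, map_mul]; rfl⟩
    · rintro ⟨c, hc⟩
      have hmk : Ideal.Quotient.mk (Ideal.span {(X : Z2P) ^ n - 1}) (c * g) =
          Ideal.Quotient.mk _ p := hc
      rw [Ideal.Quotient.eq, Ideal.mem_span_singleton] at hmk
      exact (dvd_sub_right (dvd_mul_left g c)).mp (hg.trans hmk)
  have h := f.finrank_range_add_finrank_ker
  rw [range_eq_top.mpr hf, finrank_top, hker, finrank_Rq, finrank_quotient_span_eq_natDegree] at h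
  lia

theorem span_mkQ_pair (f g : Z2P) :
    Submodule.span Z2P {mkQ n f, mkQ n g} = Submodule.span Z2P {mkQ n (gcd f g)} := by
  have h := congrArg (Submodule.map (Submodule.mkQ (Ideal.span {(X : Z2P) ^ n - 1})))
    (span_gcd f g)
  simp only [Ideal.span, Submodule.map_span, Set.image_pair, Set.image_singleton] at h
  exact h.symm

end CyclicCode

/-- Let `C = ⟨(b | 0), (ℓ | a)⟩` be a `Z₂`-double cyclic code (with the canonical conditions
on the generators) and write `C^⊥ = ⟨(b̄ | 0), (ℓ̄ | ā)⟩` with the analogous canonical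
conditions. Then `deg ā = s − deg a − deg b + deg gcd(b, ℓ)`. -/
theorem stmt13 (r s : ℕ) (hr : 0 < r) (hs : 0 < s) (b l a bb ll aa : Z2P)
    (C : Submodule Z2P (Rq r × Rq s))
    (hCdef : C = Submodule.span Z2P {((mkQ r b, 0) : Rq r × Rq s), (mkQ r l, mkQ s a)})
    (hb : b ∣ (X : Z2P) ^ r - 1) (ha : a ∣ (X : Z2P) ^ s - 1)
    (hker : C ⊓ LinearMap.ker (LinearMap.snd Z2P (Rq r) (Rq s)) =
      Submodule.span Z2P {((mkQ r b, 0) : Rq r × Rq s)})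
    (hCs : Submodule.map (LinearMap.snd Z2P (Rq r) (Rq s)) C =
      Submodule.span Z2P {mkQ s a})
    (hbb : bb ∣ (X : Z2P) ^ r - 1) (haa : aa ∣ (X : Z2P) ^ s - 1)
    (hdual : dualCode r s C =
      (Submodule.span Z2P {((mkQ r bb, 0) : Rq r × Rq s), (mkQ r ll, mkQ s aa)} :
        Set (Rq r × Rq s)))
    (hkerdual : {c : Rq r × Rq s | c ∈ dualCode r s C ∧ c.2 = 0} =
      (Submodule.span Z2P {((mkQ r bb, 0) : Rq r × Rq s)} : Set (Rq r × Rq s)))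
    (hCsdual : {q : Rq s | ∃ p : Rq r, (p, q) ∈ dualCode r s C} =
      (Submodule.span Z2P {mkQ s aa} : Set (Rq s))) :
    (aa.natDegree : ℤ) = (s : ℤ) - a.natDegree - b.natDegree + (gcd b l).natDegree := by

  have := finite_Rq hr
  have := finite_Rq hs
  let P : Submodule (ZMod 2) (Rq r × Rq s) := C.restrictScalars (ZMod 2)
  have hmem : ∀ c, c ∈ dualCode r s C ↔
      ∀ u ∈ P, innerRq hr u.1 c.1 + innerRq hs u.2 c.2 = 0 := by
    intro c
    constructor
    · rintro ⟨w, rfl, hw⟩ ⟨u₁, u₂⟩ hu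
      obtain ⟨v₁, rfl⟩ := (ofVecEquiv hr).surjective u₁
      obtain ⟨v₂, rfl⟩ := (ofVecEquiv hs).surjective u₂
      simp only [ofVecEquiv_apply, innerRq_ofVec] at hu ⊢
      exact hw (v₁, v₂) hu
    · intro h
      obtain ⟨c₁, c₂⟩ := c
      obtain ⟨w₁, rfl⟩ := (ofVecEquiv hr).surjective c₁
      obtain ⟨w₂, rfl⟩ := (ofVecEquiv hs).surjective c₂
      refine ⟨(w₁, w₂), by simp only [ofVecEquiv_apply], fun u hu => ?_⟩
      simpa only [ofVecEquiv_apply, innerRq_ofVec] using h _ hu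
  let D : Submodule (ZMod 2) (Rq r × Rq s) :=
    (Submodule.span Z2P {((mkQ r bb, 0) : Rq r × Rq s), (mkQ r ll, mkQ s aa)}).restrictScalars
      (ZMod 2)
  have hD : ∀ c, c ∈ D ↔ ∀ u ∈ P, innerRq hr u.1 c.1 + innerRq hs u.2 c.2 = 0 := by
    intro c
    rw [← hmem, hdual]
    rfl
  have key := finrank_map_snd_orthogonal (innerRq_nondegenerate hr) (innerRq_nondegenerate hs) hD
  have hDsnd : D.map (LinearMap.snd (ZMod 2) (Rq r) (Rq s)) =
      (Submodule.span Z2P {mkQ s aa}).restrictScalars (ZMod 2) := by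
    apply SetLike.coe_injective
    refine Eq.trans ?_ hCsdual
    ext q
    simp [D, hdual]
  have hPfst : P.map (LinearMap.fst (ZMod 2) (Rq r) (Rq s)) =
      (Submodule.span Z2P {mkQ r (gcd b l)}).restrictScalars (ZMod 2) := by
    rw [← span_mkQ_pair]
    have h : C.map (LinearMap.fst Z2P (Rq r) (Rq s)) = Submodule.span Z2P {mkQ r b, mkQ r l} := by
      rw [hCdef, Submodule.map_span, Set.image_pair]
      rfl
    rw [← h]
    rfl
  have hPsnd : P.map (LinearMap.snd (ZMod 2) (Rq r) (Rq s)) =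
      (Submodule.span Z2P {mkQ s a}).restrictScalars (ZMod 2) := by
    rw [← hCs]
    rfl
  have hPker : P ⊓ LinearMap.ker (LinearMap.snd (ZMod 2) (Rq r) (Rq s)) =
      ((Submodule.span Z2P {mkQ r b}).restrictScalars (ZMod 2)).map
        (LinearMap.inl (ZMod 2) (Rq r) (Rq s)) := by
    have h : (Submodule.span Z2P {mkQ r b}).map (LinearMap.inl Z2P (Rq r) (Rq s)) =
        C ⊓ LinearMap.ker (LinearMap.snd Z2P (Rq r) (Rq s)) := by
      rw [hker, Submodule.map_span, Set.image_singleton]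
      rfl
    exact (congrArg (Submodule.restrictScalars (ZMod 2)) h).symm
  have hP := P.finrank_map_add_finrank_inf_ker (LinearMap.snd (ZMod 2) (Rq r) (Rq s))
  rw [hPsnd, hPker, ← (Submodule.equivMapOfInjective _ LinearMap.inl_injective _).finrank_eq] at hP
  rw [hDsnd, hPfst, finrank_Rq] at key
  have h₁ := finrank_span_mkQ hr hb
  have h₂ := finrank_span_mkQ hs ha
  have h₃ := finrank_span_mkQ hs haa
  have h₄ := finrank_span_mkQ hr ((gcd_dvd_left b l).trans hb)
  lia
end
end
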